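/- arXiv:0811.1362 — 2 statements merged into one kernel-verified Lean document; each statement's English description precedes it below -/
import Mathlib

section
/- Fix r > 1 and let α be an irrational real number that is Diophantine of type r, i.e. there exists C > 0 with |α − p/q| ≥ C/q^{1+r} for all integers p and all positive integers q. Let g(x) = ∑_{k=-∞}^∞ c_k e^{2πikx} be a 1-periodic function whose Fourier coefficients satisfy |c_k| ≤ M/|k|^t for some t > 2r + 1 (e.g. g ∈ C^t), and such that c_k ≠ 0 for every k. Then for every integer j, the radial limit lim_{t→1⁻} |f(t e^{2πijα})| of f(z) = ∑_{n=0}^∞ g(nα) z^n is +∞. Consequently f has the unit circle as a natural boundary: it admits no analytic continuation to any open set strictly larger than the open unit disk. -/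
open Complex Filter Metric Set

/-- `α` is Diophantine of type `r`: there is `C > 0` with `|α - p/q| ≥ C/q^{1+r}`
for all integers `p` and positive integers `q`. -/
def DiophantineType (α r : ℝ) : Prop :=
  ∃ C : ℝ, 0 < C ∧ ∀ (p : ℤ) (q : ℕ), 0 < q → C / (q : ℝ) ^ (1 + r) ≤ |α - (p : ℝ) / q|

/-- The basic character `e^{2πikα}`. -/
noncomputable def ech (α : ℝ) (k : ℤ) : ℂ := Complex.exp (2 * Real.pi * Complex.I * k * α)

lemma ech_norm (α : ℝ) (k : ℤ) : ‖ech α k‖ = 1 := by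
  have h : (2 * Real.pi * Complex.I * k * α : ℂ) = ((2 * Real.pi * k * α : ℝ) : ℂ) * Complex.I := by
    push_cast; ring
  rw [ech, h, Complex.norm_exp_ofReal_mul_I]

lemma ech_add (α : ℝ) (k j : ℤ) : ech α k * ech α j = ech α (k + j) := by
  rw [ech, ech, ech, ← Complex.exp_add]; congr 1; push_cast; ring

lemma ech_zero (α : ℝ) : ech α 0 = 1 := by simp [ech]

lemma ech_ne_one {α : ℝ} (h : Irrational α) {k : ℤ} (hk : k ≠ 0) : ech α k ≠ 1 := by
  intro he
  rw [ech, Complex.exp_eq_one_iff] at he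
  obtain ⟨n, hn⟩ := he
  have h2 : (2 * Real.pi * Complex.I : ℂ) ≠ 0 := Complex.two_pi_I_ne_zero
  have h3 : (k * α : ℂ) = n := by
    apply mul_left_cancel₀ h2
    rw [← mul_assoc, hn]; ring
  have h4 : (k * α : ℝ) = n := by exact_mod_cast h3
  exact (h.intCast_mul hk).ne_int n h4

lemma summable_coeff {t M : ℝ} (ht : 1 < t) {c : ℤ → ℂ}
    (hc_bd : ∀ k : ℤ, k ≠ 0 → ‖c k‖ ≤ M / (|k| : ℝ) ^ t) : Summable (fun k => ‖c k‖) := by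
  have h1 : Summable (fun k : ℤ => M * |(k : ℝ)| ^ (-t)) :=
    (Real.summable_abs_int_rpow ht).mul_left M
  have h2 : Summable (fun k : ℤ => if k = 0 then ‖c 0‖ else 0) :=
    (hasSum_ite_eq 0 ‖c 0‖).summable
  have hb : ∀ k : ℤ, k ≠ 0 → ‖c k‖ ≤ M * |(k : ℝ)| ^ (-t) := by
    intro k hk
    have := hc_bd k hk
    rwa [div_eq_mul_inv, ← Real.rpow_neg (abs_nonneg _)] at this
  refine Summable.of_nonneg_of_le (fun _ => norm_nonneg _) (fun k => ?_) (h1.add h2)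
  by_cases hk : k = 0
  · subst hk
    have : (0 : ℝ) ^ (-t) = 0 := Real.zero_rpow (by linarith)
    simp [this]
  · simpa [hk] using hb k hk

/-- Partial fraction expansion. -/
lemma series_eq {α : ℝ} {c : ℤ → ℂ} (hs : Summable (fun k => ‖c k‖)) {g : ℝ → ℂ}
    (hg : ∀ x : ℝ, g x = ∑' k : ℤ, c k * Complex.exp (2 * Real.pi * Complex.I * k * x))
    {z : ℂ} (hz : ‖z‖ < 1) :
    ∑' n : ℕ, g ((n : ℕ) * α) * z ^ n = ∑' k : ℤ, c k * (1 - ech α k * z)⁻¹ := by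
  have hgn : ∀ n : ℕ, g ((n : ℕ) * α) * z ^ n = ∑' k : ℤ, c k * (ech α k * z) ^ n := by
    intro n
    rw [hg, ← tsum_mul_right]
    refine tsum_congr fun k => ?_
    have he : Complex.exp (2 * Real.pi * Complex.I * k * ((n * α : ℝ) : ℂ)) = ech α k ^ n := by
      rw [ech, ← Complex.exp_nat_mul]
      refine congrArg Complex.exp ?_
      rw [Complex.ofReal_mul, Complex.ofReal_natCast]
      ring
    rw [he, mul_pow, mul_assoc]
  have hsum : Summable (fun p : ℕ × ℤ => c p.2 * (ech α p.2 * z) ^ p.1) := by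
    have h1 : Summable (fun n : ℕ => ‖z‖ ^ n) := summable_geometric_of_lt_one (norm_nonneg _) hz
    have h2 := h1.mul_of_nonneg hs (fun n => by positivity) (fun n => norm_nonneg _)
    refine Summable.of_norm_bounded h2 fun p => ?_
    rw [norm_mul, norm_pow, norm_mul, ech_norm, one_mul, mul_comm]
  have hsw : ∑' n : ℕ, ∑' k : ℤ, c k * (ech α k * z) ^ n
      = ∑' k : ℤ, ∑' n : ℕ, c k * (ech α k * z) ^ n :=
    Summable.tsum_comm (f := fun (k : ℤ) (n : ℕ) => c k * (ech α k * z) ^ n) hsum.prod_symm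
  rw [tsum_congr hgn, hsw]
  refine tsum_congr fun k => ?_
  rw [tsum_mul_left, tsum_geometric_of_norm_lt_one]
  rwa [norm_mul, ech_norm, one_mul]

lemma tendsto_scaled {α : ℝ} (hirr : Irrational α) {c : ℤ → ℂ} (hs : Summable (fun k => ‖c k‖))
    {g : ℝ → ℂ}
    (hg : ∀ x : ℝ, g x = ∑' k : ℤ, c k * Complex.exp (2 * Real.pi * Complex.I * k * x)) (j : ℤ) :
    Tendsto (fun u : ℝ => ((1 - u : ℝ) : ℂ) * ∑' n : ℕ, g ((n : ℕ) * α) * ((u : ℂ) * ech α j) ^ n)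
      (nhdsWithin 1 (Set.Iio 1)) (nhds (c (-j))) := by
  have hmem : ∀ᶠ u : ℝ in nhdsWithin 1 (Set.Iio 1), u ∈ Set.Ioo (0 : ℝ) 1 :=
    Ioo_mem_nhdsLT one_pos
  have key : Tendsto (fun u : ℝ => ∑' k : ℤ, ((1 - u : ℝ) : ℂ) * (c k * (1 - ech α (k + j) * u)⁻¹))
      (nhdsWithin 1 (Set.Iio 1)) (nhds (∑' k : ℤ, if k = -j then c (-j) else 0)) := by
    refine tendsto_tsum_of_dominated_convergence hs (fun k => ?_) ?_
    · by_cases hk : k = -j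
      · subst hk
        simp only [neg_add_cancel, ech_zero, one_mul, if_true]
        refine tendsto_const_nhds.congr' ?_
        filter_upwards [hmem] with u hu
        have h1 : (1 - u : ℂ) ≠ 0 := by
          have : (1 - u : ℝ) ≠ 0 := by linarith [hu.2]
          exact_mod_cast this
        push_cast
        field_simp
      · simp only [hk, if_false]
        have h1 : (1 - ech α (k + j) * ((1 : ℝ) : ℂ)) ≠ 0 := by
          have := ech_ne_one hirr (k := k + j) (by omega)
          simpa [sub_eq_zero] using this.symm
        have hcont : ContinuousAt
            (fun u : ℝ => ((1 - u : ℝ) : ℂ) * (c k * (1 - ech α (k + j) * u)⁻¹)) 1 := by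
          refine ContinuousAt.mul (by fun_prop) (ContinuousAt.mul (by fun_prop) ?_)
          exact ContinuousAt.inv₀ (by fun_prop) h1
        have := hcont.tendsto.mono_left (nhdsWithin_le_nhds (s := Set.Iio 1))
        simpa using this
    · filter_upwards [hmem] with u hu k
      have h1 : 1 - u ≤ ‖1 - ech α (k + j) * u‖ := by
        have := norm_sub_norm_le (1 : ℂ) (ech α (k + j) * u)
        rw [norm_mul, ech_norm, norm_one, one_mul, Complex.norm_real, Real.norm_eq_abs,
          abs_of_pos hu.1] at this
        exact this
      have h0 : 0 < 1 - u := by linarith [hu.2]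
      rw [norm_mul, norm_mul, norm_inv, Complex.norm_real, Real.norm_eq_abs, abs_of_pos h0]
      have h2 : (1 - u) * ‖1 - ech α (k + j) * u‖⁻¹ ≤ 1 := by
        rw [← div_eq_mul_inv]
        exact div_le_one_of_le₀ h1 (norm_nonneg _)
      calc _ = ‖c k‖ * ((1 - u) * ‖1 - ech α (k + j) * u‖⁻¹) := by ring
        _ ≤ ‖c k‖ * 1 := by gcongr
        _ = _ := mul_one _
  rw [tsum_ite_eq] at key
  refine key.congr' ?_
  filter_upwards [hmem] with u hu
  have hz : ‖(u : ℂ) * ech α j‖ < 1 := by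
    rw [norm_mul, ech_norm, mul_one, Complex.norm_real, Real.norm_eq_abs, abs_of_pos hu.1]
    exact hu.2
  rw [series_eq hs hg hz, ← tsum_mul_left]
  refine tsum_congr fun k => ?_
  rw [← ech_add]
  congr 4
  ring

lemma tendsto_radial {α : ℝ} (hirr : Irrational α) {c : ℤ → ℂ} (hs : Summable (fun k => ‖c k‖))
    (hc_ne : ∀ k : ℤ, c k ≠ 0) {g : ℝ → ℂ}
    (hg : ∀ x : ℝ, g x = ∑' k : ℤ, c k * Complex.exp (2 * Real.pi * Complex.I * k * x)) (j : ℤ) :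
    Tendsto (fun u : ℝ => ‖∑' n : ℕ, g ((n : ℕ) * α) * ((u : ℂ) * ech α j) ^ n‖)
      (nhdsWithin 1 (Set.Iio 1)) atTop := by
  have h1 := (tendsto_scaled hirr hs hg j).norm
  have h0 : Tendsto (fun u : ℝ => (1 - u)⁻¹) (nhdsWithin 1 (Set.Iio 1)) atTop := by
    refine Tendsto.inv_tendsto_nhdsGT_zero ?_
    refine tendsto_nhdsWithin_iff.2 ⟨?_, ?_⟩
    · have : ContinuousAt (fun u : ℝ => 1 - u) 1 := by fun_prop
      simpa using this.tendsto.mono_left (nhdsWithin_le_nhds (s := Set.Iio 1))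
    · filter_upwards [self_mem_nhdsWithin] with u hu
      exact sub_pos.2 (Set.mem_Iio.1 hu)
  refine (h1.pos_mul_atTop (norm_pos_iff.2 (hc_ne _)) h0).congr' ?_
  filter_upwards [self_mem_nhdsWithin] with u hu
  have hu' : 0 < 1 - u := sub_pos.2 hu
  rw [norm_mul, Complex.norm_real, Real.norm_eq_abs, abs_of_pos hu', mul_comm, ← mul_assoc, inv_mul_cancel₀ hu'.ne', one_mul]

lemma exists_ech_near {α : ℝ} (hirr : Irrational α) {z₀ : ℂ} (hz : ‖z₀‖ = 1) {ε : ℝ} (hε : 0 < ε) :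
    ∃ j : ℤ, ech α j ∈ ball z₀ ε := by
  have hd : Dense (AddSubgroup.closure {α, 1} : Set ℝ) :=
    dense_addSubgroupClosure_pair_iff.2 (by simpa using hirr)
  have hcont : Continuous (fun x : ℝ => Complex.exp (2 * Real.pi * Complex.I * x)) := by fun_prop
  obtain ⟨x, hx, hxm⟩ := hd.exists_mem_open (isOpen_ball.preimage hcont)
    (U := (fun x : ℝ => Complex.exp (2 * Real.pi * Complex.I * x)) ⁻¹' ball z₀ ε) (by
      refine ⟨z₀.arg / (2 * Real.pi), ?_⟩
      have : Complex.exp (2 * Real.pi * Complex.I * ((z₀.arg / (2 * Real.pi) : ℝ) : ℂ)) = z₀ := by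
        have h := Complex.norm_mul_exp_arg_mul_I z₀
        rw [hz, Complex.ofReal_one, one_mul] at h
        conv_rhs => rw [← h]
        congr 1
        have : (Real.pi : ℂ) ≠ 0 := by exact_mod_cast Real.pi_ne_zero
        push_cast
        field_simp
      simp only [Set.mem_preimage]
      rw [this]
      exact mem_ball_self hε)
  obtain ⟨m, n, rfl⟩ := AddSubgroup.mem_closure_pair.1 hx
  refine ⟨m, ?_⟩
  have : Complex.exp (2 * Real.pi * Complex.I * ((m • α + n • (1 : ℝ) : ℝ) : ℂ)) = ech α m := by
    rw [ech, Complex.exp_eq_exp_iff_exists_int]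
    refine ⟨n, ?_⟩
    simp only [zsmul_eq_mul]
    push_cast
    ring
  rw [← this]
  exact hxm

/-- If `α` is irrational and Diophantine of type `r > 1` and `g` is a `1`-periodic function all
of whose Fourier coefficients are nonzero and satisfy `|c_k| ≤ M/|k|^t` with `t > 2r+1`, then the
almost periodic Taylor series `f(z) = ∑_{n=0}^∞ g(nα) z^n` has radial limit `+∞` in absolute
value at every point `e^{2πijα}`, and the unit circle is a natural boundary: `f` extends
analytically to no neighborhood of any point of the unit circle. -/
theorem natural_boundary_of_diophantine
    (r : ℝ) (hr : 1 < r) (α : ℝ) (hirr : Irrational α) (hdio : DiophantineType α r)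
    (t M : ℝ) (ht : 2 * r + 1 < t)
    (c : ℤ → ℂ) (hc_ne : ∀ k : ℤ, c k ≠ 0)
    (hc_bd : ∀ k : ℤ, k ≠ 0 → ‖c k‖ ≤ M / (|k| : ℝ) ^ t)
    (g : ℝ → ℂ)
    (hg : ∀ x : ℝ, g x = ∑' k : ℤ, c k * Complex.exp (2 * Real.pi * Complex.I * k * x)) :
    (∀ j : ℤ,
      Tendsto (fun u : ℝ =>
          ‖∑' n : ℕ, g ((n : ℕ) * α) *
            ((u : ℂ) * Complex.exp (2 * Real.pi * Complex.I * j * α)) ^ n‖)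
        (nhdsWithin 1 (Set.Iio 1)) atTop) ∧
    (∀ z₀ : ℂ, ‖z₀‖ = 1 →
      ¬ ∃ (ε : ℝ) (F : ℂ → ℂ), 0 < ε ∧
          DifferentiableOn ℂ F (ball (0 : ℂ) 1 ∪ ball z₀ ε) ∧
          Set.EqOn F (fun z : ℂ => ∑' n : ℕ, g ((n : ℕ) * α) * z ^ n) (ball (0 : ℂ) 1)) := by
  have hs : Summable (fun k => ‖c k‖) := summable_coeff (by linarith) hc_bd
  have hrad := fun j => tendsto_radial hirr hs hc_ne hg j
  refine ⟨hrad, ?_⟩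
  rintro z₀ hz₀ ⟨ε, F, hε, hF, hEq⟩
  obtain ⟨j, hj⟩ := exists_ech_near hirr hz₀ hε
  have hFc : ContinuousAt F (ech α j) :=
    (hF.continuousOn).continuousAt ((isOpen_ball.union isOpen_ball).mem_nhds (Or.inr hj))
  have hu : Tendsto (fun u : ℝ => (u : ℂ) * ech α j) (nhdsWithin 1 (Set.Iio 1))
      (nhds (ech α j)) := by
    have : ContinuousAt (fun u : ℝ => (u : ℂ) * ech α j) 1 := by fun_prop
    simpa using this.tendsto.mono_left (nhdsWithin_le_nhds (s := Set.Iio 1))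
  have hlim := (hFc.tendsto.comp hu).norm
  refine not_tendsto_nhds_of_tendsto_atTop (hrad j) _ (hlim.congr' ?_)
  have hmem : ∀ᶠ u : ℝ in nhdsWithin 1 (Set.Iio 1), u ∈ Set.Ioo (0 : ℝ) 1 :=
    Ioo_mem_nhdsLT one_pos
  filter_upwards [hmem] with u hu
  have hz : (u : ℂ) * ech α j ∈ ball (0 : ℂ) 1 := by
    rw [mem_ball_zero_iff, norm_mul, ech_norm, mul_one, Complex.norm_real, Real.norm_eq_abs,
      abs_of_pos hu.1]
    exact hu.2
  simp only [Function.comp]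
  rw [hEq hz]
end

section
/- Under the hypotheses that α is irrational and Diophantine of type r > 1 and that the Fourier coefficients of the 1-periodic function g satisfy |c_k| ≤ M/|k|^t with t > 2r + 1, the function f(z) = ∑_{n=0}^∞ g(nα) z^n satisfies, for all |z| < 1, the partial-fraction identity f(z) = ∑_{k=-∞}^∞ c_k/(1 − e^{2πikα} z), where the series on the right converges absolutely. -/
open Complex Filter Metric Set

/-- Under the hypotheses that `α` is irrational and Diophantine of type `r > 1` and the Fourier
coefficients of the `1`-periodic `g` satisfy `|c_k| ≤ M/|k|^t` with `t > 2r+1`, on the open unit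
disk the Taylor series `f(z) = ∑_{n=0}^∞ g(nα) z^n` admits the absolutely convergent
partial-fraction expansion `∑_{k ∈ ℤ} c_k / (1 - e^{2πikα} z)`. -/
theorem partial_fraction_expansion_of_taylor_series
    (r : ℝ) (hr : 1 < r) (α : ℝ) (hirr : Irrational α) (hdio : DiophantineType α r)
    (t M : ℝ) (ht : 2 * r + 1 < t)
    (c : ℤ → ℂ)
    (hc_bd : ∀ k : ℤ, k ≠ 0 → ‖c k‖ ≤ M / (|k| : ℝ) ^ t)
    (g : ℝ → ℂ)
    (hg : ∀ x : ℝ, g x = ∑' k : ℤ, c k * Complex.exp (2 * Real.pi * Complex.I * k * x)) :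
    ∀ z : ℂ, ‖z‖ < 1 →
      Summable (fun k : ℤ =>
        ‖c k / (1 - Complex.exp (2 * Real.pi * Complex.I * k * α) * z)‖) ∧
      ∑' n : ℕ, g ((n : ℕ) * α) * z ^ n
        = ∑' k : ℤ, c k / (1 - Complex.exp (2 * Real.pi * Complex.I * k * α) * z) := by
  intro z hz
  have hcs : Summable (fun k : ℤ => ‖c k‖) := by
    have h1 : Summable (fun k : ℤ => M * |(k : ℝ)| ^ (-t)) :=
      (Real.summable_abs_int_rpow (by linarith)).mul_left M
    refine Summable.of_norm_bounded_eventually h1 ?_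
    have h0 : ({0}ᶜ : Set ℤ) ∈ (cofinite : Filter ℤ) := (Set.finite_singleton 0).compl_mem_cofinite
    filter_upwards [h0] with k hk
    have h2 := hc_bd k hk
    rw [norm_norm, Real.rpow_neg (abs_nonneg _), ← div_eq_mul_inv]
    exact h2
  have hexp : ∀ k : ℤ, ‖Complex.exp (2 * Real.pi * Complex.I * k * α)‖ = 1 := by
    intro k
    have h : (2 * Real.pi * Complex.I * k * α : ℂ) = ((2 * Real.pi * k * α : ℝ) : ℂ) * Complex.I := by
      push_cast
      ring
    rw [h, Complex.norm_exp_ofReal_mul_I]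
  have hez : ∀ k : ℤ, ‖Complex.exp (2 * Real.pi * Complex.I * k * α) * z‖ = ‖z‖ := by
    intro k
    rw [norm_mul, hexp, one_mul]
  have hprod : Summable (fun p : ℤ × ℕ =>
      c p.1 * (Complex.exp (2 * Real.pi * Complex.I * p.1 * α) * z) ^ p.2) := by
    have h1 : Summable (fun p : ℤ × ℕ => ‖c p.1‖ * ‖z‖ ^ p.2) :=
      hcs.mul_of_nonneg (summable_geometric_of_lt_one (norm_nonneg z) hz)
        (fun k => norm_nonneg _) (fun n => by positivity)
    refine Summable.of_norm_bounded h1 ?_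
    intro p
    rw [norm_mul, norm_pow, hez]
  constructor
  · refine Summable.of_nonneg_of_le (fun k => norm_nonneg _) ?_ (hcs.mul_right (1 - ‖z‖)⁻¹)
    intro k
    rw [norm_div, div_eq_mul_inv]
    have h3 : 1 - ‖z‖ ≤ ‖1 - Complex.exp (2 * Real.pi * Complex.I * k * α) * z‖ := by
      have h4 := norm_sub_norm_le (1 : ℂ) (Complex.exp (2 * Real.pi * Complex.I * k * α) * z)
      rwa [hez, norm_one] at h4
    have h5 : 0 < 1 - ‖z‖ := by linarith
    gcongr
  · have hL : ∀ n : ℕ, g ((n : ℕ) * α) * z ^ n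
        = ∑' k : ℤ, c k * (Complex.exp (2 * Real.pi * Complex.I * k * α) * z) ^ n := by
      intro n
      rw [hg, ← tsum_mul_right]
      refine tsum_congr fun k => ?_
      rw [mul_pow, ← Complex.exp_nat_mul, mul_assoc]
      congr 3
      push_cast
      ring
    have hR : ∀ k : ℤ, c k / (1 - Complex.exp (2 * Real.pi * Complex.I * k * α) * z)
        = ∑' n : ℕ, c k * (Complex.exp (2 * Real.pi * Complex.I * k * α) * z) ^ n := by
      intro k
      rw [tsum_mul_left, tsum_geometric_of_norm_lt_one (by rw [hez]; exact hz), div_eq_mul_inv]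
    rw [tsum_congr hL, tsum_congr hR]
    exact Summable.tsum_comm (f := fun (k : ℤ) (n : ℕ) =>
      c k * (Complex.exp (2 * Real.pi * Complex.I * k * α) * z) ^ n) hprod
end
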